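/- arXiv:1504.06544 — 11 statements merged into one kernel-verified Lean document; each statement's English description precedes it below -/
import Mathlib

section
/- Let α > 0 and let I = (I₁,…,I_ℓ) be a partition of [n] into consecutive intervals such that d_TV(M, Φ_I(M)) ≤ α for every monotone distribution M over [n]. If a distribution D over [n] is ε-close to monotone, then d_TV(D, Φ_I(D)) ≤ 2ε + α, and moreover Φ_I(D) is ε-close to monotone. -/
open Finset

/-- A probability distribution over a finite type. -/
def IsDist {Ω : Type*} [Fintype Ω] (D : Ω → ℝ) : Prop :=
  (∀ x, 0 ≤ D x) ∧ ∑ x, D x = 1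

/-- Total variation distance. -/
noncomputable def tv {Ω : Type*} [Fintype Ω] (D₁ D₂ : Ω → ℝ) : ℝ :=
  (1 / 2) * ∑ x, |D₁ x - D₂ x|

/-- The flattening of a distribution over a partition of `Fin n` given by the index map `idx`. -/
noncomputable def flatten {n ℓ : ℕ} (idx : Fin n → Fin ℓ) (D : Fin n → ℝ) (x : Fin n) : ℝ :=
  (∑ y ∈ univ.filter (fun y => idx y = idx x), D y) /
    ((univ.filter (fun y => idx y = idx x)).card : ℝ)

theorem card_fiber_pos {n ℓ : ℕ} (idx : Fin n → Fin ℓ) (x : Fin n) :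
    (0 : ℝ) < ((univ.filter (fun y => idx y = idx x)).card : ℝ) := by
  exact_mod_cast Finset.card_pos.mpr ⟨x, by simp⟩

theorem sum_flatten {n ℓ : ℕ} (idx : Fin n → Fin ℓ) (f : Fin n → ℝ) :
    ∑ x, flatten idx f x = ∑ x, f x := by
  simp only [flatten, Finset.sum_div, Finset.sum_filter]
  rw [Finset.sum_comm]
  refine Finset.sum_congr rfl fun y _ => ?_
  have h : ∀ x, (if idx y = idx x then f y else 0) /
        ((univ.filter (fun z => idx z = idx x)).card : ℝ) =
      if idx x = idx y then f y / ((univ.filter (fun z => idx z = idx y)).card : ℝ) else 0 := by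
    intro x
    by_cases hxy : idx x = idx y
    · simp [hxy]
    · simp [hxy, Ne.symm hxy]
  have hpos := card_fiber_pos idx y
  rw [Finset.sum_congr rfl fun x _ => h x, ← Finset.sum_filter, Finset.sum_const, nsmul_eq_mul]
  field_simp

theorem abs_flatten_sub_le {n ℓ : ℕ} (idx : Fin n → Fin ℓ) (f g : Fin n → ℝ) (x : Fin n) :
    |flatten idx f x - flatten idx g x| ≤ flatten idx (fun y => |f y - g y|) x := by
  have hpos := card_fiber_pos idx x
  unfold flatten
  rw [← sub_div, ← Finset.sum_sub_distrib, abs_div, abs_of_pos hpos]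
  gcongr
  exact Finset.abs_sum_le_sum_abs _ _

theorem tv_flatten_le {n ℓ : ℕ} (idx : Fin n → Fin ℓ) (f g : Fin n → ℝ) :
    tv (flatten idx f) (flatten idx g) ≤ tv f g := by
  unfold tv
  rw [← sum_flatten idx fun y => |f y - g y|]
  gcongr with x
  exact abs_flatten_sub_le idx f g x

theorem tv_comm {Ω : Type*} [Fintype Ω] (f g : Ω → ℝ) : tv f g = tv g f := by
  simp only [tv, abs_sub_comm]

theorem tv_triangle {Ω : Type*} [Fintype Ω] (f g h : Ω → ℝ) : tv f h ≤ tv f g + tv g h := by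
  unfold tv
  rw [← mul_add, ← Finset.sum_add_distrib]
  gcongr with x
  exact abs_sub_le _ _ _

theorem IsDist.flatten {n ℓ : ℕ} (idx : Fin n → Fin ℓ) {f : Fin n → ℝ} (hf : IsDist f) :
    IsDist (flatten idx f) :=
  ⟨fun _ => div_nonneg (Finset.sum_nonneg fun y _ => hf.1 y) (Nat.cast_nonneg _),
    (sum_flatten idx f).trans hf.2⟩

theorem antitone_flatten {n ℓ : ℕ} {idx : Fin n → Fin ℓ} (hidx : Monotone idx) {f : Fin n → ℝ}
    (hf : Antitone f) : Antitone (flatten idx f) := by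
  intro a b hab
  rcases (hidx hab).eq_or_lt with h | h
  · simp [flatten, h]
  have hb : ∀ y, idx y = idx a → flatten idx f b ≤ f y := by
    intro y hy
    rw [flatten, div_le_iff₀ (card_fiber_pos idx b), mul_comm, ← nsmul_eq_mul]
    refine Finset.sum_le_card_nsmul _ _ _ fun z hz => hf (hidx.reflect_lt ?_).le
    rw [hy, (Finset.mem_filter.mp hz).2]
    exact h
  rw [flatten.eq_1 idx f a, le_div_iff₀ (card_fiber_pos idx a), mul_comm, ← nsmul_eq_mul]
  exact Finset.card_nsmul_le_sum _ _ _ fun y hy => hb y (Finset.mem_filter.mp hy).2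

/-- Let `α > 0` and `I = (I₁,…,I_ℓ)` a partition of `[n]` into consecutive intervals
(encoded by a monotone surjective `idx : Fin n → Fin ℓ` whose fibers are the intervals)
such that `d_TV(M, Φ_I(M)) ≤ α` for every monotone (non-increasing, i.e. `Antitone`)
distribution `M`.  If `D` is `ε`-close to monotone, then `d_TV(D, Φ_I(D)) ≤ 2ε + α`,
and moreover `Φ_I(D)` is `ε`-close to monotone. -/
theorem stmt_1 {n ℓ : ℕ} (α ε : ℝ) (hα : 0 < α)
    (idx : Fin n → Fin ℓ) (hmono : Monotone idx) (hsurj : Function.Surjective idx)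
    (hflat : ∀ M : Fin n → ℝ, IsDist M → Antitone M → tv M (flatten idx M) ≤ α)
    (D : Fin n → ℝ) (hD : IsDist D)
    (hclose : ∃ M : Fin n → ℝ, IsDist M ∧ Antitone M ∧ tv D M ≤ ε) :
    tv D (flatten idx D) ≤ 2 * ε + α ∧
      ∃ M : Fin n → ℝ, IsDist M ∧ Antitone M ∧ tv (flatten idx D) M ≤ ε := by
  obtain ⟨M, hM, hanti, hDM⟩ := hclose
  have hcontr : tv (flatten idx D) (flatten idx M) ≤ ε := (tv_flatten_le idx D M).trans hDM
  refine ⟨?_, flatten idx M, hM.flatten idx, antitone_flatten hmono hanti, hcontr⟩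
  have h₁ := tv_triangle D M (flatten idx D)
  have h₂ := tv_triangle M (flatten idx M) (flatten idx D)
  have h₃ := hflat M hM hanti
  rw [tv_comm (flatten idx M)] at h₂
  linarith
end

section
/- Let c > 0, let I = (I₁,…,I_k) be a partition of [n] into consecutive intervals with |I_{j+1}| = (1+c)·|I_j| for all 1 ≤ j ≤ k−1, and let D be a distribution over [n] that is a k-histogram on I and is ε-close to monotone. Set x := ε(2+c)k(k−1)/2 and λ := 1/(1+x), and define D̃ over [n] by D̃(y) = λ·(D(y) + (k−j)(2+c)ε/|I_j|) for y ∈ I_j. Then D̃ is a probability distribution over [n], D̃ is monotone (non-increasing), D̃ is a k-histogram on I, and d_TV(D, D̃) ≤ x/(1+x). -/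
open Finset

/-- The fiber sizes of `idx` are non-decreasing if consecutive ones are in ratio `1 + c`. -/
lemma monotone_card_fiber {n k : ℕ} {c : ℝ} (hc : 0 < c) (idx : Fin n → Fin k)
    (hsize : ∀ (j : Fin k) (hj : j.val + 1 < k),
      ((univ.filter (fun y => idx y = (⟨j.val + 1, hj⟩ : Fin k))).card : ℝ) =
        (1 + c) * ((univ.filter (fun y => idx y = j)).card : ℝ)) :
    Monotone fun j : Fin k => ((univ.filter (fun y => idx y = j)).card : ℝ) := by
  rcases k with _ | k
  · exact fun a => a.elim0
  · refine Fin.monotone_iff_le_succ.2 fun i => ?_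
    have h := hsize i.castSucc (by simp)
    have h' : (⟨i.castSucc.val + 1, by simp⟩ : Fin (k + 1)) = i.succ := rfl
    rw [h'] at h
    simp only [h]
    have : (0 : ℝ) ≤ ((univ.filter (fun y => idx y = i.castSucc)).card : ℝ) := by positivity
    nlinarith

/-- If `D` is `a` on `A` and `b` on `B`, with `A` to the left of `B` and `|A| ≤ |B|`, then the
increase `b - a` costs at least `|A| (b - a)` in the `ℓ¹` distance to an antitone function. -/
lemma card_mul_sub_le_of_antitone {α : Type*} [Fintype α] [LinearOrder α] {D M : α → ℝ}
    (hM : Antitone M) {A B : Finset α} (hA : A.Nonempty) (hAB : ∀ y ∈ A, ∀ z ∈ B, y < z)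
    (hcard : (A.card : ℝ) ≤ B.card) {a b : ℝ} (ha : ∀ y ∈ A, D y = a) (hb : ∀ y ∈ B, D y = b) :
    A.card * (b - a) ≤ ∑ y, |D y - M y| := by
  obtain ⟨z, hzA, hz⟩ := A.exists_min_image M hA
  have hdisj : Disjoint A B :=
    Finset.disjoint_left.2 fun y hyA hyB => (hAB y hyA y hyB).false
  have hsum : ∑ y ∈ A, |D y - M y| + ∑ y ∈ B, |D y - M y| ≤ ∑ y, |D y - M y| := by
    rw [← Finset.sum_union hdisj]
    exact Finset.sum_le_univ_sum_of_nonneg fun y => abs_nonneg _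
  have hA0 : 0 ≤ ∑ y ∈ A, |D y - M y| := Finset.sum_nonneg fun y _ => abs_nonneg _
  have hB0 : 0 ≤ ∑ y ∈ B, |D y - M y| := Finset.sum_nonneg fun y _ => abs_nonneg _
  have hA1 : A.card * (M z - a) ≤ ∑ y ∈ A, |D y - M y| := by
    rw [← nsmul_eq_mul]
    refine Finset.card_nsmul_le_sum _ _ _ fun y hy => ?_
    rw [ha y hy]
    linarith [hz y hy, neg_le_abs (a - M y)]
  have hB1 : B.card * (b - M z) ≤ ∑ y ∈ B, |D y - M y| := by
    rw [← nsmul_eq_mul]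
    refine Finset.card_nsmul_le_sum _ _ _ fun y hy => ?_
    rw [hb y hy]
    linarith [hM (hAB z hzA y hy).le, le_abs_self (b - M y)]
  have hA' : (0 : ℝ) ≤ A.card := by positivity
  rcases le_total (M z) b with h | h
  · nlinarith [mul_le_mul_of_nonneg_right hcard (sub_nonneg.2 h)]
  · nlinarith [mul_le_mul_of_nonneg_left h hA']

/-- Spreading mass `w j` uniformly over the `j`-th fiber of a surjection has total mass `∑ w`. -/
lemma sum_div_card_fiber {α β : Type*} [Fintype α] [Fintype β] [DecidableEq β] {f : α → β}
    (hf : Function.Surjective f) (w : β → ℝ) :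
    ∑ y, w (f y) / ((univ.filter (fun z => f z = f y)).card : ℝ) = ∑ j, w j := by
  rw [← Finset.sum_fiberwise univ f]
  refine Finset.sum_congr rfl fun j _ => ?_
  obtain ⟨y₀, hy₀⟩ := hf j
  have hpos : ((univ.filter (fun z => f z = j)).card : ℝ) ≠ 0 :=
    Nat.cast_ne_zero.2 (Finset.card_ne_zero_of_mem (a := y₀) (by simp [hy₀]))
  rw [Finset.sum_congr rfl (g := fun _ => w j / ((univ.filter (fun z => f z = j)).card : ℝ)),
    Finset.sum_const, nsmul_eq_mul, mul_div_cancel₀ _ hpos]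
  intro y hy
  rw [(Finset.mem_filter.1 hy).2]

lemma sum_fin_rev (k : ℕ) :
    ∑ j : Fin k, ((k : ℝ) - 1 - (j : ℕ)) = (k : ℝ) * ((k : ℝ) - 1) / 2 := by
  have h : ∀ m : ℕ, ∑ j ∈ Finset.range m, (j : ℝ) = (m : ℝ) * ((m : ℝ) - 1) / 2 := by
    intro m
    induction m with
    | zero => simp
    | succ m ih => rw [Finset.sum_range_succ, ih]; push_cast; ring
  rw [Finset.sum_sub_distrib, Fin.sum_univ_eq_sum_range (fun j => (j : ℝ)), h]
  simp
  ring

/-- Adding nonnegative mass `x` to a distribution and renormalizing gives a distribution at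
total variation distance at most `x / (1 + x)`. -/
lemma isDist_and_tv_le_of_add_mass {Ω : Type*} [Fintype Ω] {D e Dt : Ω → ℝ} {x : ℝ}
    (hD : IsDist D) (he : ∀ y, 0 ≤ e y) (hex : ∑ y, e y = x)
    (hDt : ∀ y, Dt y = 1 / (1 + x) * (D y + e y)) :
    IsDist Dt ∧ tv D Dt ≤ x / (1 + x) := by
  have hx0 : 0 ≤ x := hex ▸ Finset.sum_nonneg fun y _ => he y
  have hx1 : 1 + x ≠ 0 := by positivity
  refine ⟨⟨fun y => ?_, ?_⟩, ?_⟩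
  · have := hD.1 y
    have := he y
    rw [hDt]
    positivity
  · simp_rw [hDt]
    rw [← Finset.mul_sum, Finset.sum_add_distrib, hD.2, hex, one_div_mul_cancel hx1]
  · have hle : ∀ y, |D y - Dt y| ≤ x / (1 + x) * D y + 1 / (1 + x) * e y := by
      intro y
      have h1 : D y - Dt y = x / (1 + x) * D y - 1 / (1 + x) * e y := by
        rw [hDt]; field_simp; ring
      have h2 : 0 ≤ x / (1 + x) * D y := mul_nonneg (by positivity) (hD.1 y)
      have h3 : 0 ≤ 1 / (1 + x) * e y := mul_nonneg (by positivity) (he y)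
      rw [h1, abs_le]
      constructor <;> linarith
    have hsum := Finset.sum_le_sum fun y (_ : y ∈ univ) => hle y
    rw [Finset.sum_add_distrib, ← Finset.mul_sum, ← Finset.mul_sum, hD.2, hex] at hsum
    calc tv D Dt ≤ 1 / 2 * (x / (1 + x) * 1 + 1 / (1 + x) * x) := by
          unfold tv; gcongr
      _ = x / (1 + x) := by ring

/-- Let `c > 0`, `I = (I₁,…,I_k)` a partition of `[n]` into consecutive intervals
(encoded by a monotone surjective `idx : Fin n → Fin k`, whose fibers are the intervals,
the `j`-th interval — `1`-based — being the fiber of the `0`-based index `j-1`)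
with `|I_{j+1}| = (1+c)·|I_j|`, and `D` a `k`-histogram on `I` that is `ε`-close to monotone.
Set `x := ε(2+c)k(k−1)/2` and `λ := 1/(1+x)`, and define `D̃` by
`D̃(y) = λ·(D(y) + (k−j)(2+c)ε/|I_j|)` for `y ∈ I_j` (with `0`-based index, `k−j = k−1−idx y`).
Then `D̃` is a probability distribution, `D̃` is monotone (non-increasing, i.e. `Antitone`),
`D̃` is a `k`-histogram on `I`, and `d_TV(D, D̃) ≤ x/(1+x)`. -/
theorem stmt_3 {n k : ℕ} (c ε : ℝ) (hc : 0 < c)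
    (idx : Fin n → Fin k) (hmono : Monotone idx) (hsurj : Function.Surjective idx)
    (hsize : ∀ (j : Fin k) (hj : j.val + 1 < k),
      ((univ.filter (fun y => idx y = (⟨j.val + 1, hj⟩ : Fin k))).card : ℝ) =
        (1 + c) * ((univ.filter (fun y => idx y = j)).card : ℝ))
    (D : Fin n → ℝ) (hD : IsDist D)
    (hhist : ∀ y y', idx y = idx y' → D y = D y')
    (hclose : ∃ M : Fin n → ℝ, IsDist M ∧ Antitone M ∧ tv D M ≤ ε)
    (x lam : ℝ)
    (hx : x = ε * (2 + c) * (k : ℝ) * ((k : ℝ) - 1) / 2)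
    (hlam : lam = 1 / (1 + x))
    (Dt : Fin n → ℝ)
    (hDt : ∀ y : Fin n, Dt y =
      lam * (D y + ((k : ℝ) - 1 - ((idx y : Fin k) : ℕ)) * (2 + c) * ε /
        ((univ.filter (fun z => idx z = idx y)).card : ℝ))) :
    IsDist Dt ∧ Antitone Dt ∧ (∀ y y', idx y = idx y' → Dt y = Dt y') ∧
      tv D Dt ≤ x / (1 + x) := by
  obtain ⟨M, -, hM, hDM⟩ := hclose
  have hDM' : ∑ y, |D y - M y| ≤ 2 * ε := by unfold tv at hDM; linarith
  have hε : 0 ≤ ε := by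
    have : 0 ≤ ∑ y, |D y - M y| := Finset.sum_nonneg fun y _ => abs_nonneg _
    linarith
  have hidx : ∀ j : Fin k, (0 : ℝ) ≤ (k : ℝ) - 1 - (j : ℕ) := by
    intro j
    have : ((j : ℕ) : ℝ) + 1 ≤ k := by exact_mod_cast j.isLt
    linarith
  have he : ∀ y, 0 ≤ ((k : ℝ) - 1 - ((idx y : Fin k) : ℕ)) * (2 + c) * ε /
      ((univ.filter (fun z => idx z = idx y)).card : ℝ) := by
    intro y
    have := hidx (idx y)
    positivity
  have hex : ∑ y, ((k : ℝ) - 1 - ((idx y : Fin k) : ℕ)) * (2 + c) * ε /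
      ((univ.filter (fun z => idx z = idx y)).card : ℝ) = x := by
    rw [sum_div_card_fiber hsurj (fun j : Fin k => ((k : ℝ) - 1 - (j : ℕ)) * (2 + c) * ε),
      ← Finset.sum_mul, ← Finset.sum_mul, sum_fin_rev, hx]
    ring
  have hx0 : 0 ≤ x := hex ▸ Finset.sum_nonneg fun y _ => he y
  subst hlam
  obtain ⟨hdist, htv⟩ := isDist_and_tv_le_of_add_mass hD he hex hDt
  have hhist' : ∀ y y', idx y = idx y' → Dt y = Dt y' := by
    intro y y' h
    rw [hDt, hDt, hhist y y' h, h]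
  refine ⟨hdist, fun y y' hyy' => ?_, hhist', htv⟩
  rcases (hmono hyy').eq_or_lt with h | h
  · exact (hhist' y y' h).ge
  rw [hDt, hDt]
  refine mul_le_mul_of_nonneg_left ?_ (by positivity)
  have hst := monotone_card_fiber hc idx hsize h.le
  have hjump := card_mul_sub_le_of_antitone (D := D) hM
    (A := univ.filter fun z => idx z = idx y) (B := univ.filter fun z => idx z = idx y')
    ⟨y, by simp⟩
    (fun u hu v hv => hmono.reflect_lt (by
      rwa [(Finset.mem_filter.1 hu).2, (Finset.mem_filter.1 hv).2]))
    hst (fun u hu => hhist u y (Finset.mem_filter.1 hu).2)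
    (fun u hu => hhist u y' (Finset.mem_filter.1 hu).2)
  have hs : (0 : ℝ) < ((univ.filter (fun z => idx z = idx y)).card : ℝ) :=
    Nat.cast_pos.2 (Finset.card_pos.2 ⟨y, by simp⟩)
  have hm' := hidx (idx y')
  have hlt : ((idx y : ℕ) : ℝ) + 1 ≤ (idx y' : ℕ) := by exact_mod_cast h
  dsimp only at hst
  set s := ((univ.filter (fun z => idx z = idx y)).card : ℝ)
  set t := ((univ.filter (fun z => idx z = idx y')).card : ℝ)
  have h1 : ((k : ℝ) - 1 - (idx y' : ℕ)) * (2 + c) * ε / t ≤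
      ((k : ℝ) - 1 - (idx y' : ℕ)) * (2 + c) * ε / s := by
    gcongr
  have h2 : D y' - D y ≤ (2 + c) * ε / s := by
    rw [le_div_iff₀ hs]
    nlinarith
  have h3 : (((k : ℝ) - 1 - (idx y' : ℕ)) + 1) * (2 + c) * ε / s ≤
      ((k : ℝ) - 1 - (idx y : ℕ)) * (2 + c) * ε / s := by
    gcongr
    linarith
  have h4 : (((k : ℝ) - 1 - (idx y' : ℕ)) + 1) * (2 + c) * ε / s =
      ((k : ℝ) - 1 - (idx y' : ℕ)) * (2 + c) * ε / s + (2 + c) * ε / s := by ring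
  linarith
end

section
/- Let D be a monotone distribution over [n], let 1 ≤ i ≤ j with 2j−i+1 ≤ n and D([i,j]) < 1, and let D' = D^{(i,j)} be the faulty distribution of the missing-data model. If D([j+1, 2j−i+1]) > ε, then D' is ε/2-far from monotone, i.e. d_TV(D', M) ≥ ε/2 for every monotone distribution M over [n]. -/
open Finset

/-- A probability distribution over the domain `[n] = {1,…,n}` (as a subset of `ℕ`). -/
def IsDistOn (n : ℕ) (D : ℕ → ℝ) : Prop :=
  (∀ x, 0 ≤ D x) ∧ (∀ x, x ∉ Finset.Icc 1 n → D x = 0) ∧ ∑ x ∈ Finset.Icc 1 n, D x = 1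

/-- `D` is monotone (non-increasing) on `[n]`. -/
def MonoOn (n : ℕ) (D : ℕ → ℝ) : Prop :=
  ∀ a b, 1 ≤ a → a ≤ b → b ≤ n → D b ≤ D a

/-- Total variation distance between distributions over `[n]`. -/
noncomputable def tvOn (n : ℕ) (D₁ D₂ : ℕ → ℝ) : ℝ :=
  (1 / 2) * ∑ x ∈ Finset.Icc 1 n, |D₁ x - D₂ x|

/-- Missing-data model: let `D` be a monotone distribution over `[n]`, `1 ≤ i ≤ j` with
`2j−i+1 ≤ n` and `w := D([i,j]) < 1`, and let `D'` be the faulty distribution, defined by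
`D'(x) = D(x)/(1−w)` for `x ∉ [i,j]` and `D'(x) = 0` for `x ∈ [i,j]`.
If `D([j+1, 2j−i+1]) > ε`, then `D'` is `ε/2`-far from monotone: `d_TV(D', M) ≥ ε/2`
for every monotone distribution `M` over `[n]`. -/
theorem stmt_5 (n i j : ℕ) (ε : ℝ) (D : ℕ → ℝ)
    (hD : IsDistOn n D) (hmonoD : MonoOn n D)
    (hi : 1 ≤ i) (hij : i ≤ j) (hjn : 2 * j - i + 1 ≤ n)
    (hw : ∑ x ∈ Finset.Icc i j, D x < 1)
    (D' : ℕ → ℝ)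
    (hD'def : ∀ x, D' x = if x ∈ Finset.Icc i j then 0
      else D x / (1 - ∑ y ∈ Finset.Icc i j, D y))
    (hmass : ε < ∑ x ∈ Finset.Icc (j + 1) (2 * j - i + 1), D x) :
    ∀ M : ℕ → ℝ, IsDistOn n M → MonoOn n M → ε / 2 ≤ tvOn n D' M := by
  intro M _ hmonoM
  obtain ⟨hD0, -, -⟩ := hD
  set w := ∑ y ∈ Finset.Icc i j, D y
  have hw0 : 0 ≤ w := Finset.sum_nonneg fun x _ => hD0 x
  have hscale : ∀ x, D x ≤ D x / (1 - w) := fun x =>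
    le_div_self (hD0 x) (by linarith) (by linarith)
  have hshift (f : ℕ → ℝ) : ∑ x ∈ Finset.Icc (j + 1) (2 * j - i + 1), f x =
      ∑ x ∈ Finset.Icc i j, f (x + (j + 1 - i)) := by
    rw [← Finset.sum_image (s := Finset.Icc i j) (g := fun x => x + (j + 1 - i)) (by simp),
      Finset.image_add_right_Icc]
    congr 2 <;> omega
  have hdisj : Disjoint (Finset.Icc i j) (Finset.Icc (j + 1) (2 * j - i + 1)) := by
    rw [Finset.disjoint_left]
    intro x hx hx'
    simp only [Finset.mem_Icc] at hx hx'
    omega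
  have hsub : Finset.Icc i j ∪ Finset.Icc (j + 1) (2 * j - i + 1) ⊆ Finset.Icc 1 n := by
    intro x hx
    simp only [Finset.mem_union, Finset.mem_Icc] at hx ⊢
    omega
  have hsum : ∑ x ∈ Finset.Icc (j + 1) (2 * j - i + 1), D x ≤
      ∑ x ∈ Finset.Icc 1 n, |D' x - M x| := by
    refine le_trans ?_ (Finset.sum_le_sum_of_subset_of_nonneg hsub fun x _ _ => abs_nonneg _)
    rw [Finset.sum_union hdisj, hshift, hshift, ← Finset.sum_add_distrib]
    refine Finset.sum_le_sum fun x hx => ?_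
    have hgap := hD'def x
    rw [if_pos hx] at hgap
    rw [Finset.mem_Icc] at hx
    have hright := hD'def (x + (j + 1 - i))
    rw [if_neg (by rw [Finset.mem_Icc]; omega)] at hright
    have hmono := hmonoM x (x + (j + 1 - i)) (by omega) (by omega) (by omega)
    rw [hgap, zero_sub, abs_neg, hright]
    linarith [le_abs_self (M x), hscale (x + (j + 1 - i)),
      le_abs_self (D (x + (j + 1 - i)) / (1 - w) - M (x + (j + 1 - i)))]
  unfold tvOn
  linarith
end

section
/- Let D be a monotone distribution over [n], let 1 ≤ i ≤ j with 2j−i+1 ≤ n and D([i,j]) < 1, and let D' = D^{(i,j)} be the faulty distribution of the missing-data model. If D'([j+1, 2j−i+1]) < ε/2, then D' is ε-close to monotone, i.e. there exists a monotone distribution M over [n] with d_TV(D', M) ≤ ε. -/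
open Finset

/-- Missing-data model: let `D` be a monotone distribution over `[n]`, `1 ≤ i ≤ j` with
`2j−i+1 ≤ n` and `w := D([i,j]) < 1`, and let `D'` be the faulty distribution, defined by
`D'(x) = D(x)/(1−w)` for `x ∉ [i,j]` and `D'(x) = 0` for `x ∈ [i,j]`.
If `D'([j+1, 2j−i+1]) < ε/2`, then `D'` is `ε`-close to monotone: there exists a monotone
distribution `M` over `[n]` with `d_TV(D', M) ≤ ε`. -/
theorem stmt_6 (n i j : ℕ) (ε : ℝ) (D : ℕ → ℝ)
    (hD : IsDistOn n D) (hmonoD : MonoOn n D)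
    (hi : 1 ≤ i) (hij : i ≤ j) (hjn : 2 * j - i + 1 ≤ n)
    (hw : ∑ x ∈ Finset.Icc i j, D x < 1)
    (D' : ℕ → ℝ)
    (hD'def : ∀ x, D' x = if x ∈ Finset.Icc i j then 0
      else D x / (1 - ∑ y ∈ Finset.Icc i j, D y))
    (hmass : ∑ x ∈ Finset.Icc (j + 1) (2 * j - i + 1), D' x < ε / 2) :
    ∃ M : ℕ → ℝ, IsDistOn n M ∧ MonoOn n M ∧ tvOn n D' M ≤ ε := by
  obtain ⟨hD0, hDs, hD1⟩ := hD
  have hanti : ∀ a b, 1 ≤ a → a ≤ b → D b ≤ D a := by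
    intro a b ha hab
    by_cases hb : b ≤ n
    · exact hmonoD a b ha hab hb
    · rw [hDs b (by simp; omega)]
      exact hD0 a
  have hw' : 0 < 1 - ∑ y ∈ Finset.Icc i j, D y := by linarith
  have hin : ∀ x, i ≤ x → x ≤ j → D' x = 0 := by
    intro x h1 h2
    rw [hD'def, if_pos (by simp; omega)]
  have hout : ∀ x, (x < i ∨ j < x) → D' x = D x / (1 - ∑ y ∈ Finset.Icc i j, D y) := by
    intro x h
    rw [hD'def, if_neg (by simp; omega)]
  have hD'0 : ∀ x, 0 ≤ D' x := by
    intro x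
    rw [hD'def]
    split_ifs
    · exact le_rfl
    · exact div_nonneg (hD0 x) hw'.le
  have hD's : ∀ x, x ∉ Finset.Icc 1 n → D' x = 0 := by
    intro x hx
    rw [hD'def, hDs x hx]
    simp
  have hD'anti : ∀ a b, 1 ≤ a → a ≤ b → (a < i ∨ j < a) → D' b ≤ D' a := by
    intro a b ha hab h
    by_cases hb : b < i ∨ j < b
    · rw [hout a h, hout b hb]
      exact div_le_div_of_nonneg_right (hanti a b ha hab) hw'.le
    · rw [hin b (by omega) (by omega)]
      exact hD'0 a
  have hIcc : ∀ a b : ℕ, Finset.Icc a b = Finset.Ico a (b + 1) := by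
    intro a b
    ext x
    simp only [Finset.mem_Icc, Finset.mem_Ico]
    omega
  have hsplit : ∀ f : ℕ → ℝ, ∑ x ∈ Finset.Icc 1 n, f x =
      ∑ x ∈ Finset.Ico 1 i, f x + ∑ x ∈ Finset.Icc i j, f x
        + ∑ x ∈ Finset.Ico (j + 1) (n + 1), f x := by
    intro f
    rw [hIcc, hIcc, Finset.sum_Ico_consecutive f hi (by omega),
      Finset.sum_Ico_consecutive f (by omega) (by omega)]
  have hD'sum : ∑ x ∈ Finset.Ico 1 i, D' x + ∑ x ∈ Finset.Ico (j + 1) (n + 1), D' x = 1 := by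
    rw [Finset.sum_congr rfl fun x hx => hout x (Or.inl (Finset.mem_Ico.1 hx).2),
      Finset.sum_congr (s₁ := Finset.Ico (j + 1) (n + 1)) rfl
        fun x hx => hout x (Or.inr (Finset.mem_Ico.1 hx).1),
      ← Finset.sum_div, ← Finset.sum_div, ← add_div, div_eq_one_iff_eq hw'.ne']
    linarith [hsplit D]
  obtain ⟨L, hL⟩ : ∃ L, i + L = j + 1 := ⟨j + 1 - i, by omega⟩
  let M : ℕ → ℝ := fun x => if x < i then D' x else D' (x + L)
  have hMlt : ∀ x, x < i → M x = D' x := fun x hx => if_pos hx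
  have hMge : ∀ x, i ≤ x → M x = D' (x + L) := fun x hx => if_neg (by omega)
  have hMsum : ∑ x ∈ Finset.Icc 1 n, M x = 1 := by
    rw [hIcc, ← Finset.sum_Ico_consecutive M hi (by omega : i ≤ n + 1),
      Finset.sum_congr rfl fun x hx => hMlt x (Finset.mem_Ico.1 hx).2,
      Finset.sum_congr (s₁ := Finset.Ico i (n + 1)) rfl
        fun x hx => hMge x (Finset.mem_Ico.1 hx).1,
      Finset.sum_Ico_add', hL,
      ← Finset.sum_Ico_consecutive D' (by omega : j + 1 ≤ n + 1)
        (by omega : n + 1 ≤ n + 1 + L),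
      Finset.sum_eq_zero (s := Finset.Ico (n + 1) (n + 1 + L)) fun x hx => hD's x ?_, add_zero]
    · exact hD'sum
    · simp only [Finset.mem_Ico, Finset.mem_Icc] at hx ⊢
      omega
  have hMin : ∑ x ∈ Finset.Icc i j, M x = ∑ x ∈ Finset.Icc (j + 1) (2 * j - i + 1), D' x := by
    rw [Finset.sum_congr rfl fun x hx => hMge x (Finset.mem_Icc.1 hx).1, hIcc, hIcc,
      Finset.sum_Ico_add', hL, show j + 1 + L = 2 * j - i + 1 + 1 by omega]
  refine ⟨M, ⟨?_, ?_, hMsum⟩, ?_, ?_⟩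
  · intro x
    rcases lt_or_ge x i with h | h
    · rw [hMlt x h]; exact hD'0 _
    · rw [hMge x h]; exact hD'0 _
  · intro x hx
    rcases lt_or_ge x i with h | h
    · rw [hMlt x h]; exact hD's _ hx
    · rw [hMge x h]
      apply hD's
      simp only [Finset.mem_Icc] at hx ⊢
      omega
  · intro a b ha hab _
    rcases lt_or_ge a i with h | h
    · rw [hMlt a h]
      rcases lt_or_ge b i with h' | h'
      · rw [hMlt b h']; exact hD'anti a b ha hab (Or.inl h)
      · rw [hMge b h']; exact hD'anti a _ ha (by omega) (Or.inl h)
    · rw [hMge a h, hMge b (by omega)]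
      exact hD'anti _ _ (by omega) (by omega) (by omega)
  · have h₁ : ∑ x ∈ Finset.Ico 1 i, |D' x - M x| = 0 :=
      Finset.sum_eq_zero fun x hx => by simp [hMlt x (Finset.mem_Ico.1 hx).2]
    have h₂ : ∑ x ∈ Finset.Icc i j, |D' x - M x| = ∑ x ∈ Finset.Icc i j, M x := by
      refine Finset.sum_congr rfl fun x hx => ?_
      rw [Finset.mem_Icc] at hx
      rw [hin x hx.1 hx.2, hMge x hx.1, zero_sub, abs_neg, abs_of_nonneg (hD'0 _)]
    have h₃ : ∑ x ∈ Finset.Ico (j + 1) (n + 1), |D' x - M x| =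
        ∑ x ∈ Finset.Ico (j + 1) (n + 1), D' x - ∑ x ∈ Finset.Ico (j + 1) (n + 1), M x := by
      rw [← Finset.sum_sub_distrib]
      refine Finset.sum_congr rfl fun x hx => abs_of_nonneg ?_
      rw [Finset.mem_Ico] at hx
      rw [hMge x (by omega), sub_nonneg]
      exact hD'anti _ _ (by omega) (by omega) (by omega)
    have h₄ : ∑ x ∈ Finset.Ico 1 i, M x = ∑ x ∈ Finset.Ico 1 i, D' x :=
      Finset.sum_congr rfl fun x hx => hMlt x (Finset.mem_Ico.1 hx).2
    have h₅ : 0 ≤ ∑ x ∈ Finset.Icc (j + 1) (2 * j - i + 1), D' x :=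
      Finset.sum_nonneg fun x _ => hD'0 x
    have h₆ := hsplit M
    rw [tvOn, hsplit, h₁, h₂, h₃]
    linarith
end

section
/- For any finite abelian group G and any probability distributions D₁, D₂ on G, d_TV(U_G, D₁⊛D₂) ≤ 2·d_TV(U_G, D₁)·d_TV(U_G, D₂). -/
open Finset

/-- Convolution of two distributions on a finite abelian group. -/
noncomputable def conv {G : Type*} [Fintype G] [AddCommGroup G] (D₁ D₂ : G → ℝ) (x : G) : ℝ :=
  ∑ g, D₁ (x - g) * D₂ g

/-- The uniform distribution on a finite type. -/
noncomputable def unif (G : Type*) [Fintype G] : G → ℝ := fun _ => 1 / (Fintype.card G : ℝ)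

theorem sum_abs_conv_le {G : Type*} [Fintype G] [AddCommGroup G] (f g : G → ℝ) :
    ∑ x, |conv f g x| ≤ (∑ x, |f x|) * ∑ x, |g x| := by
  calc ∑ x, |conv f g x| ≤ ∑ x, ∑ y, |f (x - y)| * |g y| :=
        Finset.sum_le_sum fun x _ => by
          simpa only [conv, abs_mul] using
            Finset.abs_sum_le_sum_abs (fun y => f (x - y) * g y) Finset.univ
    _ = ∑ y, (∑ x, |f x|) * |g y| := by
        rw [Finset.sum_comm]
        refine Finset.sum_congr rfl fun y _ => ?_
        rw [← Finset.sum_mul]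
        exact congrArg (· * |g y|) ((Equiv.subRight y).sum_comp fun x => |f x|)
    _ = _ := (Finset.mul_sum ..).symm

theorem conv_unif_sub_unif_sub {G : Type*} [Fintype G] [AddCommGroup G] {D₁ D₂ : G → ℝ}
    (h₁ : ∑ x, D₁ x = 1) (h₂ : ∑ x, D₂ x = 1) (x : G) :
    conv (fun y => unif G y - D₁ y) (fun y => unif G y - D₂ y) x =
      conv D₁ D₂ x - unif G x := by
  have hcard : (Fintype.card G : ℝ) ≠ 0 := Nat.cast_ne_zero.mpr Fintype.card_ne_zero
  have h : ∑ y, D₁ (x - y) = 1 := ((Equiv.subLeft x).sum_comp D₁).trans h₁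
  simp only [conv, unif, sub_mul, mul_sub, Finset.sum_sub_distrib, ← Finset.mul_sum,
    ← Finset.sum_mul, h, h₂, Finset.sum_const, Finset.card_univ, nsmul_eq_mul]
  field_simp
  ring

/-- For any finite abelian group `G` and any probability distributions `D₁, D₂` on `G`,
`d_TV(U_G, D₁⊛D₂) ≤ 2·d_TV(U_G, D₁)·d_TV(U_G, D₂)`. -/
theorem stmt_7 {G : Type*} [Fintype G] [AddCommGroup G]
    (D₁ D₂ : G → ℝ) (h₁ : IsDist D₁) (h₂ : IsDist D₂) :
    tv (unif G) (conv D₁ D₂) ≤ 2 * tv (unif G) D₁ * tv (unif G) D₂ := by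
  have h := sum_abs_conv_le (fun y => unif G y - D₁ y) (fun y => unif G y - D₂ y)
  simp only [conv_unif_sub_unif_sub h₁.2 h₂.2, abs_sub_comm (conv D₁ D₂ _)] at h
  unfold tv
  linarith
end

section
/- Let D be a probability distribution on a finite abelian group G and set ε := d_TV(D, U_G). Then for every integer k ≥ 1, the k-fold convolution D^{⊛k} satisfies d_TV(D^{⊛k}, U_G) ≤ 2^{k−1}·ε^k, and consequently ε − 2^{k−1}ε^k ≤ d_TV(D, D^{⊛k}) ≤ ε + 2^{k−1}ε^k. -/
open Finset

/-- The `k`-fold convolution `D^{⊛k}` of `D` with itself (with `D^{⊛0}` the point mass at `0`,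
so that `D^{⊛1} = D` as a distribution). -/
noncomputable def convIter {G : Type*} [Fintype G] [DecidableEq G] [AddCommGroup G]
    (D : G → ℝ) : ℕ → G → ℝ
  | 0 => fun x => if x = 0 then 1 else 0
  | k + 1 => conv (convIter D k) D

theorem sum_conv {G : Type*} [Fintype G] [AddCommGroup G] (f g : G → ℝ) :
    ∑ x, conv f g x = (∑ x, f x) * ∑ x, g x := by
  simp only [conv]
  rw [sum_comm, mul_sum]
  refine sum_congr rfl fun y _ => ?_
  rw [← sum_mul]
  exact congrArg (· * g y) (Equiv.sum_comp (Equiv.subRight y) f)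

theorem conv_sub_unif {G : Type*} [Fintype G] [AddCommGroup G] (f g : G → ℝ)
    (hf : ∑ x, f x = 1) (hg : ∑ x, g x = 1) (x : G) :
    conv f g x - unif G x = conv (fun y => f y - unif G y) (fun y => g y - unif G y) x := by
  have hf' : ∑ y, f (x - y) = 1 := (Equiv.sum_comp (Equiv.subLeft x) f).trans hf
  have hG : (Fintype.card G : ℝ) ≠ 0 := by
    have : Nonempty G := ⟨0⟩
    exact_mod_cast Fintype.card_ne_zero
  simp only [conv, unif, sub_mul, mul_sub, sum_sub_distrib, ← sum_mul, ← mul_sum, hf', hg,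
    sum_const, card_univ, nsmul_eq_mul]
  field_simp
  ring

theorem tv_conv_unif_le {G : Type*} [Fintype G] [AddCommGroup G] (f g : G → ℝ)
    (hf : ∑ x, f x = 1) (hg : ∑ x, g x = 1) :
    tv (conv f g) (unif G) ≤ 2 * tv f (unif G) * tv g (unif G) := by
  have h := sum_abs_conv_le (fun y => f y - unif G y) (fun y => g y - unif G y)
  simp only [← conv_sub_unif f g hf hg] at h
  unfold tv
  linarith

theorem tv_nonneg {Ω : Type*} [Fintype Ω] (f g : Ω → ℝ) : 0 ≤ tv f g :=
  mul_nonneg (by norm_num) (sum_nonneg fun _ _ => abs_nonneg _)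

theorem sum_convIter {G : Type*} [Fintype G] [DecidableEq G] [AddCommGroup G] (D : G → ℝ)
    (hD : ∑ x, D x = 1) (k : ℕ) : ∑ x, convIter D k x = 1 := by
  induction k with
  | zero => simp [convIter]
  | succ k ih => rw [convIter, sum_conv, ih, hD, one_mul]

theorem convIter_one {G : Type*} [Fintype G] [DecidableEq G] [AddCommGroup G] (D : G → ℝ) :
    convIter D 1 = D := by
  ext x
  simp [convIter, conv, sub_eq_zero]

theorem tv_convIter_unif_le {G : Type*} [Fintype G] [DecidableEq G] [AddCommGroup G]
    (D : G → ℝ) (hD : ∑ x, D x = 1) (k : ℕ) :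
    tv (convIter D (k + 1)) (unif G) ≤ 2 ^ k * tv D (unif G) ^ (k + 1) := by
  induction k with
  | zero => simp [convIter_one]
  | succ k ih =>
    calc tv (convIter D (k + 1 + 1)) (unif G)
        ≤ 2 * tv (convIter D (k + 1)) (unif G) * tv D (unif G) :=
          tv_conv_unif_le _ _ (sum_convIter D hD _) hD
      _ ≤ 2 * (2 ^ k * tv D (unif G) ^ (k + 1)) * tv D (unif G) := by
          gcongr
          exact tv_nonneg _ _
      _ = 2 ^ (k + 1) * tv D (unif G) ^ (k + 1 + 1) := by ring

/-- Let `D` be a probability distribution on a finite abelian group `G` and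
`ε := d_TV(D, U_G)`.  Then for every `k ≥ 1`, the `k`-fold convolution satisfies
`d_TV(D^{⊛k}, U_G) ≤ 2^{k−1}·ε^k`, and consequently
`ε − 2^{k−1}ε^k ≤ d_TV(D, D^{⊛k}) ≤ ε + 2^{k−1}ε^k`. -/
theorem stmt_8 {G : Type*} [Fintype G] [DecidableEq G] [AddCommGroup G]
    (D : G → ℝ) (hD : IsDist D) (ε : ℝ) (hε : ε = tv D (unif G))
    (k : ℕ) (hk : 1 ≤ k) :
    tv (convIter D k) (unif G) ≤ 2 ^ (k - 1) * ε ^ k ∧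
      ε - 2 ^ (k - 1) * ε ^ k ≤ tv D (convIter D k) ∧
      tv D (convIter D k) ≤ ε + 2 ^ (k - 1) * ε ^ k := by
  obtain ⟨k, rfl⟩ := Nat.exists_eq_add_of_le' hk
  subst hε
  have h := tv_convIter_unif_le D hD.2 k
  have h₁ := tv_triangle D (convIter D (k + 1)) (unif G)
  have h₂ := tv_triangle D (unif G) (convIter D (k + 1))
  rw [tv_comm (unif G)] at h₂
  rw [Nat.add_sub_cancel]
  exact ⟨h, by linarith, by linarith⟩
end

section
/- Let ε ∈ (0, 1/2] and 0 < α < ε², and define real sequences (u_j)_{j≥0}, (v_j)_{j≥0} by u₀ = ε, u_{j+1} = u_j/2 + α, v₀ = 0, v_{j+1} = v_j + u_j/2 + 2u_j³ + α. Then for every k ≥ 0: u_k = ε/2^k + 2(1 − 2^{−k})α, and v_k < (1 − 2^{−k})ε + 3kα + 23ε³. -/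
/-- Bound on the cubic term at the point `ε x + 2 (1 - x) α` between `2 α` and `ε`. -/
lemma two_mul_interp_cube_le {ε α x : ℝ} (hε0 : 0 < ε) (hε : ε ≤ 1 / 2) (hα0 : 0 < α)
    (hα : α < ε ^ 2) (hx0 : 0 < x) (hx1 : x ≤ 1) :
    2 * (ε * x + 2 * (1 - x) * α) ^ 3 ≤ α + 6 * ε ^ 3 * x := by
  obtain ⟨y, rfl⟩ : ∃ y, x = 1 - y := ⟨1 - x, by ring⟩
  have hy0 : 0 ≤ y := by linarith
  have hy1 : y ≤ 1 := by linarith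
  have hαε : α ≤ ε / 2 := by nlinarith
  have hα_sq : α ^ 2 ≤ (ε / 2) ^ 2 := by gcongr
  have hα_cube : 16 * α ^ 3 ≤ α := by
    have : α ^ 2 ≤ 1 / 16 := by nlinarith
    nlinarith
  have hy3 : y ^ 3 ≤ 1 := pow_le_one₀ hy0 hy1
  have h₀ : 16 * α ^ 3 * y ^ 3 ≤ α :=
    (mul_le_of_le_one_right (by positivity) hy3).trans hα_cube
  have h₁ : 12 * ε ^ 2 * (1 - y) ^ 2 * y * α ≤ 12 * ε ^ 2 * (1 - y) ^ 2 * y * (ε / 2) := by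
    gcongr
  have h₂ : 24 * ε * (1 - y) * y ^ 2 * α ^ 2 ≤ 24 * ε * (1 - y) * y ^ 2 * (ε / 2) ^ 2 := by
    gcongr
  have h₃ : 0 ≤ ε ^ 3 * (1 - y) * (6 - (2 * (1 - y) ^ 2 + 6 * (1 - y) * y + 6 * y ^ 2)) :=
    mul_nonneg (by positivity) (by nlinarith)
  linarith

/-- Let `ε ∈ (0, 1/2]` and `0 < α < ε²`, and define real sequences `(u_j)`, `(v_j)` by
`u₀ = ε`, `u_{j+1} = u_j/2 + α`, `v₀ = 0`, `v_{j+1} = v_j + u_j/2 + 2u_j³ + α`.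
Then for every `k ≥ 0`: `u_k = ε/2^k + 2(1 − 2^{−k})α` and
`v_k < (1 − 2^{−k})ε + 3kα + 23ε³`. -/
theorem stmt_10 (ε α : ℝ) (hε0 : 0 < ε) (hε : ε ≤ 1 / 2) (hα0 : 0 < α) (hα : α < ε ^ 2)
    (u v : ℕ → ℝ)
    (hu0 : u 0 = ε) (hu : ∀ j, u (j + 1) = u j / 2 + α)
    (hv0 : v 0 = 0) (hv : ∀ j, v (j + 1) = v j + u j / 2 + 2 * u j ^ 3 + α)
    (k : ℕ) :
    u k = ε / 2 ^ k + 2 * (1 - 1 / 2 ^ k) * α ∧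
      v k < (1 - 1 / 2 ^ k) * ε + 3 * k * α + 23 * ε ^ 3 := by
  have hu_eq : ∀ j, u j = ε / 2 ^ j + 2 * (1 - 1 / 2 ^ j) * α := by
    intro j
    induction j with
    | zero => simp [hu0]
    | succ j ih =>
      rw [hu, ih]
      field_simp
      ring
  refine ⟨hu_eq k, ?_⟩
  have hv_le : v k ≤ (1 - 1 / 2 ^ k) * ε + 3 * k * α + 23 * ε ^ 3 * (1 - 1 / 2 ^ k) := by
    induction k with
    | zero => simp [hv0]
    | succ j ih =>
      have hx0 : (0 : ℝ) < 1 / 2 ^ j := by positivity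
      have hx1 : (1 : ℝ) / 2 ^ j ≤ 1 :=
        div_le_one_of_le₀ (one_le_pow₀ one_le_two) (by positivity)
      have hx : (1 : ℝ) / 2 ^ (j + 1) = 1 / 2 ^ j / 2 := by
        field_simp
        ring
      have huj : u j = ε * (1 / 2 ^ j) + 2 * (1 - 1 / 2 ^ j) * α := by
        rw [hu_eq]
        ring
      rw [hv, hx, huj]
      push_cast
      generalize (1 : ℝ) / 2 ^ j = x at *
      have hcube := two_mul_interp_cube_le hε0 hε hα0 hα hx0 hx1
      have hαx : 0 < α * x := by positivity
      have hεx : 0 < ε ^ 3 * x := by positivity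
      linarith
  have : 0 < ε ^ 3 * (1 / 2 ^ k) := by positivity
  linarith
end

section
/- Let G be a finite group, H a subgroup of G, U_H the uniform distribution on H (U_H(x) = 1/|H| for x ∈ H and 0 otherwise), and D a probability distribution on G with d_TV(D, U_H) < 1. Then D(H) > 0, and the conditional distribution D_H, defined by D_H(x) = D(x)/D(H) for x ∈ H and D_H(x) = 0 otherwise, satisfies d_TV(D_H, U_H) ≤ d_TV(D, U_H). -/
open Finset

/-- The total variation distance of two distributions is the total positive part of their
difference. -/
theorem tv_eq_sum_max {Ω : Type*} [Fintype Ω] {D E : Ω → ℝ} (hD : IsDist D) (hE : IsDist E) :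
    tv D E = ∑ x, max (E x - D x) 0 := by
  have key : ∀ x, |D x - E x| = 2 * max (E x - D x) 0 + D x - E x := by
    intro x
    rcases le_total (D x) (E x) with h | h
    · rw [abs_of_nonpos (by linarith), max_eq_left (by linarith)]; ring
    · rw [abs_of_nonneg (by linarith), max_eq_right (by linarith)]; ring
  rw [tv, sum_congr rfl fun x _ => key x, sum_sub_distrib, sum_add_distrib, ← mul_sum,
    hD.2, hE.2]
  ring

theorem isDist_uniform_subgroup {G : Type*} [Group G] [Fintype G] (H : Subgroup G)
    [DecidablePred (· ∈ H)] :
    IsDist fun x => if x ∈ H then 1 / (Nat.card H : ℝ) else 0 := by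
  refine ⟨fun x => by dsimp only; split_ifs <;> positivity, ?_⟩
  have hcard : (univ.filter (· ∈ H)).card = Nat.card H := by
    rw [Nat.card_eq_fintype_card, Fintype.card_subtype]
  have hpos : (Nat.card H : ℝ) ≠ 0 := Nat.cast_ne_zero.2 Nat.card_pos.ne'
  rw [← sum_filter, sum_const, hcard, nsmul_eq_mul, mul_one_div_cancel hpos]

/-- Conditioning a distribution on an event of positive probability gives a distribution. -/
theorem IsDist.cond {Ω : Type*} [Fintype Ω] {D : Ω → ℝ} (hD : IsDist D) (p : Ω → Prop)
    [DecidablePred p] (hp : 0 < ∑ x ∈ univ.filter p, D x) :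
    IsDist fun x => if p x then D x / (∑ y ∈ univ.filter p, D y) else 0 := by
  refine ⟨fun x => ?_, ?_⟩
  · dsimp only
    split_ifs
    · exact div_nonneg (hD.1 x) hp.le
    · exact le_rfl
  · rw [← sum_filter, ← sum_div, div_self hp.ne']

/-- Let `G` be a finite group, `H` a subgroup of `G`, `U_H` the uniform distribution on `H`
(`U_H(x) = 1/|H|` for `x ∈ H` and `0` otherwise), and `D` a probability distribution on `G`
with `d_TV(D, U_H) < 1`.  Then `D(H) > 0`, and the conditional distribution `D_H`, defined
by `D_H(x) = D(x)/D(H)` for `x ∈ H` and `D_H(x) = 0` otherwise, satisfies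
`d_TV(D_H, U_H) ≤ d_TV(D, U_H)`. -/
theorem stmt_11 {G : Type*} [Group G] [Fintype G]
    (H : Subgroup G) [DecidablePred (· ∈ H)]
    (D : G → ℝ) (hD : IsDist D)
    (UH : G → ℝ) (hUH : ∀ x, UH x = if x ∈ H then 1 / (Nat.card H : ℝ) else 0)
    (hclose : tv D UH < 1) :
    0 < ∑ x ∈ univ.filter (· ∈ H), D x ∧
      tv (fun x => if x ∈ H then D x / (∑ y ∈ univ.filter (· ∈ H), D y) else 0) UH ≤
        tv D UH := by
  obtain rfl : UH = fun x => if x ∈ H then 1 / (Nat.card H : ℝ) else 0 := funext hUH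
  have hU := isDist_uniform_subgroup H
  have hpos : 0 < ∑ x ∈ univ.filter (· ∈ H), D x := by
    refine (sum_nonneg fun x _ => hD.1 x).lt_of_ne' fun h0 => hclose.not_ge ?_
    rw [sum_eq_zero_iff_of_nonneg fun x _ => hD.1 x] at h0
    rw [tv_eq_sum_max hD hU]
    refine hU.2.symm.trans_le (sum_le_sum fun x _ => ?_)
    by_cases hx : x ∈ H
    · rw [h0 x (by simpa using hx), sub_zero]
      exact le_max_left _ _
    · simp only [if_neg hx]
      exact le_max_right _ _
  refine ⟨hpos, ?_⟩
  have hle : ∑ x ∈ univ.filter (· ∈ H), D x ≤ 1 :=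
    hD.2 ▸ sum_le_sum_of_subset_of_nonneg (filter_subset _ _) fun x _ _ => hD.1 x
  rw [tv_eq_sum_max (hD.cond (· ∈ H) hpos) hU, tv_eq_sum_max hD hU]
  refine sum_le_sum fun x _ => ?_
  by_cases hx : x ∈ H
  · simp only [if_pos hx]
    exact max_le_max (sub_le_sub_left (le_div_self (hD.1 x) hpos hle) _) le_rfl
  · simp only [if_neg hx, sub_self, max_self]
    exact le_max_right _ _
end

section
/- For every rational δ ∈ (1/2, 1) there exists N such that for every integer n ≥ N with (1−δ)n/2 ∈ ℤ the following holds: letting ℓ := (1−δ)n/2 and D be the uniform distribution on the set A := {ℓ, ℓ+1, …, ℓ+δn−1} of residues in Z_n, one has d_TV(D, U_{Z_n}) = 1−δ and d_TV(D, D⊛D) > 1−δ. In particular, convolving a distribution at distance ε = 1−δ from uniform with itself can strictly increase its distance from the original distribution beyond ε. -/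
open Finset

/-- Total variation distance between two distributions on `Z_n`
(encoded as functions on the residues `{0,…,n−1} ⊆ ℕ`). -/
noncomputable def tvMod (n : ℕ) (D₁ D₂ : ℕ → ℝ) : ℝ :=
  (1 / 2) * ∑ x ∈ Finset.range n, |D₁ x - D₂ x|

/-- Convolution of two distributions on `Z_n` (encoded as functions on `{0,…,n−1} ⊆ ℕ`):
`(D₁⊛D₂)(x) = Σ_{g} D₁(x−g)·D₂(g)`, subtraction taken modulo `n`. -/
noncomputable def convMod (n : ℕ) (D₁ D₂ : ℕ → ℝ) (x : ℕ) : ℝ :=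
  ∑ g ∈ Finset.range n, D₁ ((x + n - g) % n) * D₂ g

/-- The uniform distribution on the subset `A = {ℓ, …, n−ℓ−1}` of `Z_n`
(`|A| = n − 2ℓ`, so each element gets mass `1/(n−2ℓ)` and the rest gets `0`). -/
noncomputable def unifA (n ℓ : ℕ) : ℕ → ℝ := fun x =>
  if x ∈ Finset.Ico ℓ (n - ℓ) then 1 / ((n : ℝ) - 2 * (ℓ : ℝ)) else 0

lemma unifA_of_mem {n ℓ x : ℕ} (h₁ : ℓ ≤ x) (h₂ : x < n - ℓ) :
    unifA n ℓ x = 1 / ((n : ℝ) - 2 * (ℓ : ℝ)) :=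
  if_pos (mem_Ico.2 ⟨h₁, h₂⟩)

lemma unifA_of_notMem {n ℓ x : ℕ} (h : x < ℓ ∨ n - ℓ ≤ x) : unifA n ℓ x = 0 :=
  if_neg fun hx => by rw [mem_Ico] at hx; omega

lemma unifA_nonneg {n ℓ : ℕ} (h : 2 * ℓ ≤ n) (x : ℕ) : 0 ≤ unifA n ℓ x := by
  have h' : (2 * ℓ : ℝ) ≤ n := by exact_mod_cast h
  unfold unifA
  split_ifs
  · exact one_div_nonneg.2 (by linarith)
  · exact le_rfl

/-- Splitting a sum over `Z_n` into its parts below, on and above the set `{ℓ, …, n−ℓ−1}`. -/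
lemma sum_range_split {n ℓ : ℕ} (h : 2 * ℓ ≤ n) (f : ℕ → ℝ) :
    ∑ x ∈ range n, f x = ∑ x ∈ range ℓ, f x + ∑ x ∈ range (n - 2 * ℓ), f (ℓ + x) +
      ∑ x ∈ range ℓ, f (n - ℓ + x) := by
  rw [← sum_range_add, ← (by omega : n - ℓ = ℓ + (n - 2 * ℓ)), ← sum_range_add,
    (by omega : n - ℓ + ℓ = n)]

lemma sum_unifA {n ℓ : ℕ} (h : 2 * ℓ < n) : ∑ x ∈ range n, unifA n ℓ x = 1 := by
  have h' : (2 * ℓ : ℝ) < n := by exact_mod_cast h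
  rw [sum_range_split h.le,
    sum_congr rfl fun x hx => unifA_of_notMem (Or.inl (mem_range.1 hx)),
    sum_congr rfl fun x hx => unifA_of_mem (Nat.le_add_right ℓ x)
      (by have := mem_range.1 hx; omega),
    sum_congr rfl fun x _ => unifA_of_notMem (Or.inr (Nat.le_add_right (n - ℓ) x))]
  simp only [sum_const, card_range, nsmul_eq_mul, Nat.cast_sub h.le]
  push_cast
  rw [mul_zero, zero_add, add_zero, mul_one_div_cancel (by linarith)]

lemma sum_range_sub_mod {n g : ℕ} (hg : g < n) (f : ℕ → ℝ) :
    ∑ x ∈ range n, f ((x + n - g) % n) = ∑ x ∈ range n, f x := by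
  refine sum_nbij' (fun x => (x + n - g) % n) (fun x => (x + g) % n) ?_ ?_ ?_ ?_ ?_
  · exact fun x _ => mem_range.2 (Nat.mod_lt _ (by omega))
  · exact fun x _ => mem_range.2 (Nat.mod_lt _ (by omega))
  · intro x hx
    have hx := mem_range.1 hx
    rw [Nat.mod_add_mod, (by omega : x + n - g + g = x + n), Nat.add_mod_right,
      Nat.mod_eq_of_lt hx]
  · intro x hx
    have hx := mem_range.1 hx
    rw [(by omega : (x + g) % n + n - g = (x + g) % n + (n - g)), Nat.mod_add_mod,
      (by omega : x + g + (n - g) = x + n), Nat.add_mod_right, Nat.mod_eq_of_lt hx]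
  · exact fun x _ => rfl

lemma sum_convMod (n : ℕ) (D₁ D₂ : ℕ → ℝ) :
    ∑ x ∈ range n, convMod n D₁ D₂ x = (∑ x ∈ range n, D₁ x) * ∑ x ∈ range n, D₂ x := by
  unfold convMod
  rw [sum_comm, mul_sum]
  refine sum_congr rfl fun g hg => ?_
  rw [← sum_mul, sum_range_sub_mod (mem_range.1 hg)]

lemma le_convMod_unifA {n ℓ x a b : ℕ} (h : 2 * ℓ ≤ n) (hab : a ≤ b)
    (hg : ∀ g, a ≤ g → g < b → (ℓ ≤ g ∧ g < n - ℓ) ∧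
      ℓ ≤ (x + n - g) % n ∧ (x + n - g) % n < n - ℓ) :
    ((b : ℝ) - a) / ((n : ℝ) - 2 * ℓ) ^ 2 ≤ convMod n (unifA n ℓ) (unifA n ℓ) x := by
  calc ((b : ℝ) - a) / ((n : ℝ) - 2 * ℓ) ^ 2
      = ∑ _g ∈ Ico a b, 1 / ((n : ℝ) - 2 * ℓ) * (1 / ((n : ℝ) - 2 * ℓ)) := by
        rw [sum_const, Nat.card_Ico, nsmul_eq_mul, Nat.cast_sub hab, div_mul_div_comm, one_mul,
          mul_one_div, pow_two]
    _ = ∑ g ∈ Ico a b, unifA n ℓ ((x + n - g) % n) * unifA n ℓ g := by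
        refine sum_congr rfl fun g hg' => ?_
        obtain ⟨h₁, h₂⟩ := hg g (mem_Ico.1 hg').1 (mem_Ico.1 hg').2
        rw [unifA_of_mem h₁.1 h₁.2, unifA_of_mem h₂.1 h₂.2]
    _ ≤ convMod n (unifA n ℓ) (unifA n ℓ) x := by
        refine sum_le_sum_of_subset_of_nonneg (fun g hg' => mem_range.2 ?_)
          fun g _ _ => mul_nonneg (unifA_nonneg h _) (unifA_nonneg h _)
        have := (hg g (mem_Ico.1 hg').1 (mem_Ico.1 hg').2).1
        omega

lemma le_convMod_unifA_low {n ℓ x : ℕ} (h : 4 * ℓ < n) (hx : x < ℓ) :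
    ((n : ℝ) - 2 * ℓ - x - 1) / ((n : ℝ) - 2 * ℓ) ^ 2 ≤
      convMod n (unifA n ℓ) (unifA n ℓ) x := by
  refine le_of_eq_of_le ?_ (le_convMod_unifA (a := x + ℓ + 1) (b := n - ℓ) (by omega) (by omega)
    fun g h₁ h₂ => ?_)
  · rw [Nat.cast_sub (by omega)]
    push_cast
    ring
  · rw [Nat.mod_eq_of_lt (by omega)]
    omega

lemma le_convMod_unifA_high {n ℓ x : ℕ} (h : 4 * ℓ < n) (hx : x < ℓ) :
    ((n : ℝ) - 3 * ℓ + x + 1) / ((n : ℝ) - 2 * ℓ) ^ 2 ≤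
      convMod n (unifA n ℓ) (unifA n ℓ) (n - ℓ + x) := by
  refine le_of_eq_of_le ?_ (le_convMod_unifA (a := ℓ) (b := n - 2 * ℓ + x + 1) (by omega)
    (by omega) fun g h₁ h₂ => ?_)
  · push_cast [Nat.cast_sub (by omega : 2 * ℓ ≤ n)]
    ring
  · rw [(by omega : n - ℓ + x + n - g = n - ℓ + x - g + n), Nat.add_mod_right,
      Nat.mod_eq_of_lt (by omega)]
    omega

lemma tvMod_unifA_uniform {n ℓ : ℕ} (h : 2 * ℓ < n) :
    tvMod n (unifA n ℓ) (fun _ => 1 / (n : ℝ)) = 2 * ℓ / n := by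
  have h' : (2 * ℓ : ℝ) < n := by exact_mod_cast h
  have hℓ : (0 : ℝ) ≤ ℓ := ℓ.cast_nonneg
  have hn : (0 : ℝ) < n := by linarith
  have hm : (0 : ℝ) < n - 2 * ℓ := by linarith
  have hle : 1 / (n : ℝ) ≤ 1 / (n - 2 * ℓ) := one_div_le_one_div_of_le hm (by linarith)
  unfold tvMod
  rw [sum_range_split h.le,
    sum_congr rfl fun x hx => by rw [unifA_of_notMem (Or.inl (mem_range.1 hx))],
    sum_congr (s₁ := range (n - 2 * ℓ)) rfl fun x hx => by
      rw [unifA_of_mem (Nat.le_add_right ℓ x) (by have := mem_range.1 hx; omega),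
        abs_of_nonneg (sub_nonneg.2 hle)],
    sum_congr (s₁ := range ℓ) (f := fun x => |unifA n ℓ (n - ℓ + x) - 1 / (n : ℝ)|) rfl
      fun x _ => by rw [unifA_of_notMem (Or.inr (Nat.le_add_right (n - ℓ) x))]]
  simp only [sum_const, card_range, nsmul_eq_mul, Nat.cast_sub h.le, zero_sub, abs_neg,
    abs_of_pos (one_div_pos.2 hn)]
  push_cast
  field_simp
  ring

/-- Twice the mass of `C` outside `{ℓ, …, n−ℓ−1}` bounds the `L¹` distance from `unifA n ℓ`. -/
lemma le_tvMod_unifA {n ℓ : ℕ} (h : 2 * ℓ < n) {C : ℕ → ℝ} (hC : ∑ x ∈ range n, C x = 1) :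
    ∑ x ∈ range ℓ, (C x + C (n - ℓ + x)) ≤ tvMod n (unifA n ℓ) C := by
  have hD := sum_unifA h
  have h₀ : ∑ x ∈ range n, (unifA n ℓ x - C x) = 0 := by rw [sum_sub_distrib, hD, hC, sub_self]
  rw [sum_range_split h.le] at h₀
  unfold tvMod
  rw [sum_range_split h.le, sum_add_distrib]
  have h₁ : ∑ x ∈ range ℓ, (unifA n ℓ x - C x) = -∑ x ∈ range ℓ, C x := by
    rw [← sum_neg_distrib]
    exact sum_congr rfl fun x hx => by rw [unifA_of_notMem (Or.inl (mem_range.1 hx)), zero_sub]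
  have h₂ : ∑ x ∈ range ℓ, (unifA n ℓ (n - ℓ + x) - C (n - ℓ + x)) =
      -∑ x ∈ range ℓ, C (n - ℓ + x) := by
    rw [← sum_neg_distrib]
    exact sum_congr rfl fun x _ => by
      rw [unifA_of_notMem (Or.inr (Nat.le_add_right (n - ℓ) x)), zero_sub]
  have h₃ := (neg_le_abs _).trans
    (abs_sum_le_sum_abs (fun x => unifA n ℓ x - C x) (range ℓ))
  have h₄ := (le_abs_self _).trans
    (abs_sum_le_sum_abs (fun x => unifA n ℓ (ℓ + x) - C (ℓ + x)) (range (n - 2 * ℓ)))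
  have h₅ := (neg_le_abs _).trans
    (abs_sum_le_sum_abs (fun x => unifA n ℓ (n - ℓ + x) - C (n - ℓ + x)) (range ℓ))
  linarith

lemma lt_tvMod_unifA_convMod {n ℓ : ℕ} (hℓ : 0 < ℓ) (h : 4 * ℓ < n) :
    2 * ℓ / n < tvMod n (unifA n ℓ) (convMod n (unifA n ℓ) (unifA n ℓ)) := by
  have hℓ' : (0 : ℝ) < ℓ := by exact_mod_cast hℓ
  have h' : (4 * ℓ : ℝ) < n := by exact_mod_cast h
  have hm : (0 : ℝ) < n - 2 * ℓ := by linarith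
  refine lt_of_lt_of_le ?_ (le_tvMod_unifA (by omega)
    (by rw [sum_convMod, sum_unifA (by omega), one_mul]))
  calc (2 * ℓ / n : ℝ)
      < ℓ * ((2 * n - 5 * ℓ) / ((n : ℝ) - 2 * ℓ) ^ 2) := by
        rw [← mul_div_assoc, div_lt_div_iff₀ (by linarith) (by positivity)]
        nlinarith [mul_pos (mul_pos hℓ' hℓ') (by linarith : (0 : ℝ) < 3 * n - 8 * ℓ)]
    _ = ∑ x ∈ range ℓ, (((n : ℝ) - 2 * ℓ - x - 1) / ((n : ℝ) - 2 * ℓ) ^ 2 +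
          ((n : ℝ) - 3 * ℓ + x + 1) / ((n : ℝ) - 2 * ℓ) ^ 2) := by
        rw [sum_congr rfl fun x _ => by rw [← add_div, show (n : ℝ) - 2 * ℓ - x - 1 +
          (n - 3 * ℓ + x + 1) = 2 * n - 5 * ℓ by ring]]
        rw [sum_const, card_range, nsmul_eq_mul]
    _ ≤ _ := sum_le_sum fun x hx => add_le_add (le_convMod_unifA_low h (mem_range.1 hx))
        (le_convMod_unifA_high h (mem_range.1 hx))

/-- For every rational `δ ∈ (1/2, 1)` there exists `N` such that for every integer `n ≥ N`
with `(1−δ)n/2 ∈ ℤ` (say `(1−δ)n/2 = ℓ ∈ ℕ`) the following holds: letting `D` be the uniform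
distribution on the set `A := {ℓ, ℓ+1, …, ℓ+δn−1} = {ℓ, …, n−ℓ−1}` of residues in `Z_n`
(note `δn = n − 2ℓ`), one has `d_TV(D, U_{Z_n}) = 1−δ` and `d_TV(D, D⊛D) > 1−δ`. -/
theorem stmt_12 (δ : ℚ) (hδ1 : 1 / 2 < δ) (hδ2 : δ < 1) :
    ∃ N : ℕ, ∀ n : ℕ, N ≤ n → ∀ ℓ : ℕ, (ℓ : ℚ) = (1 - δ) * (n : ℚ) / 2 →
      tvMod n (unifA n ℓ) (fun _ => 1 / (n : ℝ)) = 1 - (δ : ℝ) ∧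
      1 - (δ : ℝ) < tvMod n (unifA n ℓ) (convMod n (unifA n ℓ) (unifA n ℓ)) := by
  refine ⟨1, fun n hn ℓ hℓ => ?_⟩
  have hn' : (0 : ℚ) < n := by exact_mod_cast hn
  have hpos : 0 < ℓ := by
    have : (0 : ℚ) < ℓ := by
      rw [hℓ]
      exact half_pos (mul_pos (sub_pos.2 hδ2) hn')
    exact_mod_cast this
  have hlt : 4 * ℓ < n := by
    have : (4 * ℓ : ℚ) < n := by
      rw [hℓ]
      nlinarith
    exact_mod_cast this
  have hδ : 1 - (δ : ℝ) = 2 * ℓ / n := by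
    have : 1 - δ = 2 * ℓ / n := by
      rw [hℓ]
      field_simp
    simpa using congrArg (Rat.cast : ℚ → ℝ) this
  rw [hδ]
  exact ⟨tvMod_unifA_uniform (by omega), lt_tvMod_unifA_convMod hpos hlt⟩
end

section
/- Let P and Q be probability distributions over a finite set Ω and let S₁,…,S_K be a partition of Ω with P(S_j) > 0 for every j. Define P' by P'(x) = P(x)·Q(S_j)/P(S_j) for x ∈ S_j. Then P' is a probability distribution over Ω, and d_TV(P', Q) ≤ 2·d_TV(P, Q). -/
open Finset

theorem sum_eq_sum_sum_of_existsUnique_mem {Ω ι M : Type*} [Fintype Ω] [Fintype ι]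
    [AddCommMonoid M] (S : ι → Finset Ω) (hS : ∀ x, ∃! j, x ∈ S j) (f : Ω → M) :
    ∑ x, f x = ∑ j, ∑ x ∈ S j, f x := by
  classical
  rw [Finset.sum_comm' (t' := Finset.univ) (s' := fun x => Finset.univ.filter (x ∈ S ·))
    (by simp)]
  refine Finset.sum_congr rfl fun x _ => ?_
  obtain ⟨j, hj, hu⟩ := hS x
  have hfilter : Finset.univ.filter (x ∈ S ·) = {j} := by
    ext i
    simp only [Finset.mem_filter, Finset.mem_univ, true_and, Finset.mem_singleton]
    exact ⟨hu i, fun h => h ▸ hj⟩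
  rw [hfilter, Finset.sum_singleton]

theorem sum_mul_div_sum {Ω : Type*} (s : Finset Ω) (P : Ω → ℝ) (hs : ∑ x ∈ s, P x ≠ 0)
    (q : ℝ) : ∑ x ∈ s, P x * q / ∑ y ∈ s, P y = q := by
  rw [← Finset.sum_div, ← Finset.sum_mul, mul_div_cancel_left₀ q hs]

theorem sum_abs_rescale_sub_le {Ω : Type*} (s : Finset Ω) (P Q : Ω → ℝ)
    (hP : ∀ x ∈ s, 0 ≤ P x) (hs : 0 < ∑ x ∈ s, P x) :
    ∑ x ∈ s, |P x * (∑ y ∈ s, Q y) / (∑ y ∈ s, P y) - Q x| ≤ 2 * ∑ x ∈ s, |P x - Q x| := by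
  set p := ∑ y ∈ s, P y with hp
  set q := ∑ y ∈ s, Q y with hq
  have hdiff : ∑ x ∈ s, |P x * q / p - P x| = |p - q| := by
    have h : ∀ x ∈ s, |P x * q / p - P x| = P x * |p - q| / p := fun x hx => by
      rw [show P x * q / p - P x = P x * (q - p) / p by field_simp, abs_div, abs_mul,
        abs_of_nonneg (hP x hx), abs_of_pos hs, abs_sub_comm]
    rw [Finset.sum_congr rfl h, sum_mul_div_sum s P hs.ne']
  have hblock : |p - q| ≤ ∑ x ∈ s, |P x - Q x| := by
    rw [hp, hq, ← Finset.sum_sub_distrib]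
    exact Finset.abs_sum_le_sum_abs _ _
  calc ∑ x ∈ s, |P x * q / p - Q x|
      ≤ ∑ x ∈ s, (|P x * q / p - P x| + |P x - Q x|) :=
        Finset.sum_le_sum fun x _ => abs_sub_le _ _ _
    _ ≤ 2 * ∑ x ∈ s, |P x - Q x| := by
        rw [Finset.sum_add_distrib, hdiff]
        linarith

/-- Let `P` and `Q` be probability distributions over a finite set `Ω` and `S₁,…,S_K` a
partition of `Ω` with `P(S_j) > 0` for every `j`.  Define `P'` by
`P'(x) = P(x)·Q(S_j)/P(S_j)` for `x ∈ S_j`.  Then `P'` is a probability distribution over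
`Ω`, and `d_TV(P', Q) ≤ 2·d_TV(P, Q)`. -/
theorem stmt_14 {Ω : Type*} [Fintype Ω] {K : ℕ} (S : Fin K → Finset Ω)
    (hpart : ∀ x : Ω, ∃! j : Fin K, x ∈ S j)
    (P Q : Ω → ℝ) (hP : IsDist P) (hQ : IsDist Q)
    (hpos : ∀ j, 0 < ∑ x ∈ S j, P x)
    (P' : Ω → ℝ)
    (hP' : ∀ j : Fin K, ∀ x ∈ S j, P' x = P x * (∑ y ∈ S j, Q y) / (∑ y ∈ S j, P y)) :
    IsDist P' ∧ tv P' Q ≤ 2 * tv P Q := by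
  refine ⟨⟨fun x => ?_, ?_⟩, ?_⟩
  · obtain ⟨j, hj, -⟩ := hpart x
    rw [hP' j x hj]
    exact div_nonneg (mul_nonneg (hP.1 x) (Finset.sum_nonneg fun y _ => hQ.1 y)) (hpos j).le
  · rw [sum_eq_sum_sum_of_existsUnique_mem S hpart, ← hQ.2,
      sum_eq_sum_sum_of_existsUnique_mem S hpart Q]
    refine Finset.sum_congr rfl fun j _ => ?_
    rw [Finset.sum_congr rfl (hP' j), sum_mul_div_sum _ _ (hpos j).ne']
  · have h : ∑ x, |P' x - Q x| ≤ 2 * ∑ x, |P x - Q x| := by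
      rw [sum_eq_sum_sum_of_existsUnique_mem S hpart,
        sum_eq_sum_sum_of_existsUnique_mem S hpart (fun x => |P x - Q x|), Finset.mul_sum]
      refine Finset.sum_le_sum fun j _ => ?_
      rw [Finset.sum_congr rfl fun x hx => by rw [hP' j x hx]]
      exact sum_abs_rescale_sub_le (S j) P Q (fun x _ => hP.1 x) (hpos j)
    unfold tv
    linarith
end

section
/- Let I = (I₁,…,I_ℓ) be a partition of [n] into consecutive intervals and let D be a distribution over [n] that is an ℓ-histogram on I and is ε-close to monotone. Then there exists a monotone distribution M over [n] which is itself an ℓ-histogram on I and satisfies d_TV(D, M) ≤ ε. -/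
open Finset

/-- The average of `f` over the fiber of `g` through `y`. -/
noncomputable def fiberAvg {α β : Type*} [Fintype α] [DecidableEq β] (g : α → β) (f : α → ℝ)
    (y : α) : ℝ :=
  (∑ z with g z = g y, f z) / #{z | g z = g y}

section fiberAvg

variable {α β : Type*} [Fintype α] [DecidableEq β] (g : α → β) (f : α → ℝ)

theorem card_fiber_pos_s15 (y : α) : (0 : ℝ) < #{z | g z = g y} := by
  exact_mod_cast card_pos.mpr ⟨y, by simp⟩

theorem fiberAvg_congr {y y' : α} (h : g y = g y') : fiberAvg g f y = fiberAvg g f y' := by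
  simp only [fiberAvg, h]

theorem fiberAvg_nonneg (hf : ∀ x, 0 ≤ f x) (y : α) : 0 ≤ fiberAvg g f y :=
  div_nonneg (sum_nonneg fun x _ => hf x) (card_fiber_pos_s15 g y).le

theorem sum_fiberAvg : ∑ y, fiberAvg g f y = ∑ y, f y := by
  simp only [fiberAvg, sum_filter, sum_div]
  rw [sum_comm]
  refine sum_congr rfl fun z _ => ?_
  have h : ∀ y, (if g z = g y then f z else 0) / (#{x | g x = g y} : ℝ) =
      if g y = g z then f z / (#{x | g x = g z} : ℝ) else 0 := by
    intro y
    by_cases hy : g y = g z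
    · simp [hy]
    · simp [hy, Ne.symm hy]
  rw [sum_congr rfl fun y _ => h y, ← sum_filter, sum_const, nsmul_eq_mul]
  exact mul_div_cancel₀ _ (card_fiber_pos_s15 g z).ne'

theorem abs_sub_fiberAvg_le {d : α → ℝ} (hd : ∀ y y', g y = g y' → d y = d y') (y : α) :
    |d y - fiberAvg g f y| ≤ fiberAvg g (fun z => |d z - f z|) y := by
  have hc := card_fiber_pos_s15 g y
  have h : d y - fiberAvg g f y =
      (∑ z with g z = g y, (d z - f z)) / #{z | g z = g y} := by
    have hs : ∑ z with g z = g y, d z = #{z | g z = g y} * d y := by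
      rw [sum_congr rfl fun z hz => hd z y (by simpa using hz), sum_const, nsmul_eq_mul]
    rw [sum_sub_distrib, hs, fiberAvg]
    field_simp
  rw [h, abs_div, abs_of_pos hc, fiberAvg]
  exact div_le_div_of_nonneg_right (abs_sum_le_sum_abs _ _) hc.le

/-- Averaging over fibers does not increase the distance to a function constant on fibers. -/
theorem tv_fiberAvg_le {d : α → ℝ} (hd : ∀ y y', g y = g y' → d y = d y') :
    tv d (fiberAvg g f) ≤ tv d f := by
  unfold tv
  rw [← sum_fiberAvg g fun z => |d z - f z|]
  gcongr with y
  exact abs_sub_fiberAvg_le g f hd y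

end fiberAvg

theorem antitone_fiberAvg {α β : Type*} [Fintype α] [LinearOrder α] [LinearOrder β]
    {g : α → β} (hg : Monotone g) {f : α → ℝ} (hf : Antitone f) : Antitone (fiberAvg g f) := by
  intro y y' hy
  rcases (hg hy).eq_or_lt with h | h
  · exact (fiberAvg_congr g f h).ge
  unfold fiberAvg
  rw [div_le_div_iff₀ (card_fiber_pos_s15 g y') (card_fiber_pos_s15 g y), sum_mul, sum_mul]
  calc ∑ z' with g z' = g y', f z' * (#{z | g z = g y} : ℝ)
      = ∑ z' with g z' = g y', ∑ z with g z = g y, f z' := by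
        simp only [sum_const, nsmul_eq_mul, mul_comm]
    _ ≤ ∑ z' with g z' = g y', ∑ z with g z = g y, f z := by
        refine sum_le_sum fun z' hz' => sum_le_sum fun z hz => hf ?_
        simp only [mem_filter, mem_univ, true_and] at hz hz'
        exact (hg.reflect_lt (hz.trans_lt (h.trans_eq hz'.symm))).le
    _ = ∑ z with g z = g y, f z * (#{z' | g z' = g y'} : ℝ) := by
        rw [sum_comm]
        simp only [sum_const, nsmul_eq_mul, mul_comm]

/-- Let `I = (I₁,…,I_ℓ)` be a partition of `[n]` into consecutive intervals (encoded by a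
monotone surjective `idx : Fin n → Fin ℓ` whose fibers are the intervals) and `D` a
distribution over `[n]` that is an `ℓ`-histogram on `I` (constant on each interval) and is
`ε`-close to monotone (non-increasing, i.e. `Antitone`).  Then there exists a monotone
distribution `M` over `[n]` which is itself an `ℓ`-histogram on `I` and satisfies
`d_TV(D, M) ≤ ε`. -/
theorem stmt_15 {n ℓ : ℕ} (idx : Fin n → Fin ℓ) (hmono : Monotone idx)
    (hsurj : Function.Surjective idx) (ε : ℝ)
    (D : Fin n → ℝ) (hD : IsDist D)
    (hhist : ∀ y y', idx y = idx y' → D y = D y')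
    (hclose : ∃ M : Fin n → ℝ, IsDist M ∧ Antitone M ∧ tv D M ≤ ε) :
    ∃ M : Fin n → ℝ, IsDist M ∧ Antitone M ∧
      (∀ y y', idx y = idx y' → M y = M y') ∧ tv D M ≤ ε := by
  obtain ⟨M, ⟨hM0, hM1⟩, hMa, hMt⟩ := hclose
  exact ⟨fiberAvg idx M, ⟨fiberAvg_nonneg idx M hM0, (sum_fiberAvg idx M).trans hM1⟩,
    antitone_fiberAvg hmono hMa, fun _ _ => fiberAvg_congr idx M,
    (tv_fiberAvg_le idx M hhist).trans hMt⟩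
end
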